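/- arXiv:2104.10540 — 3 statements merged into one kernel-verified Lean document; each statement's English description precedes it below -/
import Mathlib

section
/- (Hermite's generalization of Binet's first formula, exponentiated form.) Let z, η be complex numbers with Re z > 0 and Re(z+η) > 0. Then Γ(z+η) = √(2π) · z^{z+η−1/2} · exp( −z + ∫_0^∞ (1/s) ( η − 1/2 − 1/s + e^{(1−η)s}/(e^s − 1) ) e^{−zs} ds ), where Γ is the complex Gamma function and z^{w} denotes the principal branch of the complex power. -/
open MeasureTheory Complex Real

namespace HB
open Filter Topology Set

/-- the elementary kernel -/
noncomputable def Ek (z w : ℂ) (s : ℝ) : ℂ :=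
  (1 / (s : ℂ)) * ((w - z - 1/2 - 1/(s:ℂ)) * Complex.exp (-z * s)
    + (1/2 + 1/(s:ℂ)) * Complex.exp (-w * s))

/-- Binet's kernel -/
noncomputable def Bk (s : ℝ) : ℝ := (1 / (Real.exp s - 1) - 1 / s + 1/2) / s

lemma Bk_bound {s : ℝ} (hs : 0 < s) : |Bk s| ≤ 1/2 := by
  have he : 0 < Real.exp s - 1 := by linarith [Real.add_one_lt_exp hs.ne']
  have hq := Real.quadratic_le_exp_of_nonneg hs.le
  have hN : 0 ≤ (s - 2) * Real.exp s + s + 2 := by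
    have hd : ∀ x : ℝ, HasDerivAt (fun s : ℝ => (s - 2) * Real.exp s + s + 2)
        (1 * Real.exp x + (x - 2) * Real.exp x + 1) x := fun x =>
      ((((hasDerivAt_id x).sub_const 2).mul (Real.hasDerivAt_exp x)).add (hasDerivAt_id x)).add_const 2
    have hm : Monotone (fun s : ℝ => (s - 2) * Real.exp s + s + 2) := by
      apply monotone_of_deriv_nonneg (fun x => (hd x).differentiableAt)
      intro x
      rw [(hd x).deriv]
      have h1 := Real.add_one_le_exp (-x)
      have h2 : Real.exp (-x) * Real.exp x = 1 := by rw [← Real.exp_add]; simp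
      nlinarith [Real.exp_pos x]
    have := hm hs.le
    simpa using this
  have hB : Bk s = ((s - 2) * Real.exp s + s + 2) / (2 * s^2 * (Real.exp s - 1)) := by
    unfold Bk
    field_simp
    ring
  rw [hB, abs_of_nonneg (by positivity), div_le_iff₀ (by positivity)]
  nlinarith [mul_le_mul_of_nonneg_right hq (by nlinarith [sq_nonneg (s-1)] : 0 ≤ s^2 - s + 2),
    pow_pos hs 3, pow_pos hs 4, sq_nonneg (s^2 - s), sq_nonneg s]

lemma Bk_meas : Measurable Bk := by unfold Bk; fun_prop

lemma mu_norm {w : ℂ} {s : ℝ} (hs : 0 < s) :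
    ‖(Bk s : ℂ) * Complex.exp (-w * s)‖ ≤ 1/2 * Real.exp (-w.re * s) := by
  rw [norm_mul, Complex.norm_real, Complex.norm_exp]
  have : (-w * (s:ℂ)).re = -w.re * s := by simp
  rw [this]
  exact mul_le_mul_of_nonneg_right (Bk_bound hs) (Real.exp_pos _).le

lemma mu_integrable {w : ℂ} (hw : 0 < w.re) :
    IntegrableOn (fun s : ℝ => (Bk s : ℂ) * Complex.exp (-w * s)) (Ioi 0) := by
  have h1 : IntegrableOn (fun s : ℝ => 1/2 * Real.exp (-w.re * s)) (Ioi 0) :=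
    (integrableOn_exp_mul_Ioi (by linarith) 0).const_mul _
  refine Integrable.mono' h1 ?_ ?_
  · have := Bk_meas
    exact Measurable.aestronglyMeasurable (by fun_prop)
  · filter_upwards [ae_restrict_mem measurableSet_Ioi] with s hs using mu_norm hs

noncomputable def mu (w : ℂ) : ℂ := ∫ s in Ioi (0:ℝ), (Bk s : ℂ) * Complex.exp (-w * s)

lemma mu_le {w : ℂ} (hw : 0 < w.re) : ‖mu w‖ ≤ 1/2 / w.re := by
  have h1 : IntegrableOn (fun s : ℝ => 1/2 * Real.exp (-w.re * s)) (Ioi 0) :=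
    (integrableOn_exp_mul_Ioi (by linarith) 0).const_mul _
  have h := norm_integral_le_of_norm_le h1 (f := fun s : ℝ => (Bk s : ℂ) * Complex.exp (-w * s))
    (by filter_upwards [ae_restrict_mem measurableSet_Ioi] with s hs using mu_norm hs)
  rw [integral_const_mul, integral_exp_mul_Ioi (by linarith)] at h
  unfold mu
  refine h.trans (le_of_eq ?_)
  simp
  field_simp

lemma mu_tendsto {w : ℂ} (hw : 0 < w.re) :
    Tendsto (fun n : ℕ => mu (w + n + 1)) atTop (𝓝 0) := by
  have h2 : Tendsto (fun n : ℕ => 1/2 / (w.re + (n:ℝ) + 1)) atTop (𝓝 0) := by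
    apply Tendsto.const_div_atTop
    apply tendsto_atTop_add_const_right
    exact tendsto_atTop_add_const_left _ _ tendsto_natCast_atTop_atTop
  refine squeeze_zero_norm (fun n => ?_) h2
  have h3 : (w + n + 1).re = w.re + n + 1 := by simp
  rw [← h3]
  apply mu_le
  rw [h3]; positivity

lemma seg_re {z w : ℂ} {t : ℝ} (ht : t ∈ Icc (0:ℝ) 1) :
    min z.re w.re ≤ (z + t * (w - z)).re := by
  have : (z + t * (w - z)).re = (1-t) * z.re + t * w.re := by simp; ring
  rw [this]
  have h1 := mul_le_mul_of_nonneg_left (min_le_left z.re w.re) (sub_nonneg.2 ht.2)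
  have h2 := mul_le_mul_of_nonneg_left (min_le_right z.re w.re) ht.1
  linarith

/-- integrand of the double integral -/
noncomputable def Dk (z w : ℂ) (s t : ℝ) : ℂ :=
  ((w - z)^2 * (1 - t) - (w - z)/2) * Complex.exp (-(z + t * (w - z)) * s)

lemma Ek_eq (z w : ℂ) {s : ℝ} (hs : 0 < s) :
    ∫ t in Ioc (0:ℝ) 1, Dk z w s t = Ek z w s := by
  have hsc : (s : ℂ) ≠ 0 := by exact_mod_cast hs.ne'
  rw [← intervalIntegral.integral_of_le zero_le_one,
    intervalIntegral.integral_eq_sub_of_hasDerivAt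
      (f := fun t : ℝ => Complex.exp (-(z + t * (w - z)) * s) *
        (-(w-z) * (1 - t) / s + 1/(s:ℂ)^2 + 1/(2*s)))]
  · unfold Ek
    have e1 : -(z + (1:ℂ) * (w - z)) * s = -w * s := by ring
    have e0 : -(z + (0:ℂ) * (w - z)) * s = -z * s := by ring
    push_cast
    rw [e1, e0]
    field_simp
    ring
  · intro t _
    have ht : HasDerivAt (fun t : ℝ => (t : ℂ)) 1 t := Complex.ofRealCLM.hasDerivAt
    have h1 := ((((ht.mul_const (w-z)).const_add z).neg).mul_const (s:ℂ)).cexp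
    have h2 := (((((ht.const_sub 1).const_mul (-(w-z))).div_const (s:ℂ)).add_const
      (1/(s:ℂ)^2)).add_const (1/(2*(s:ℂ))))
    refine (h1.mul h2).congr_deriv ?_
    unfold Dk
    simp only [Pi.neg_apply]
    field_simp
    ring
  · apply Continuous.intervalIntegrable
    unfold Dk
    fun_prop

lemma Dk_integrable {z w : ℂ} (hz : 0 < z.re) (hw : 0 < w.re) :
    Integrable (Function.uncurry (Dk z w))
      ((volume.restrict (Ioi (0:ℝ))).prod (volume.restrict (Ioc (0:ℝ) 1))) := by
  set m := min z.re w.re with hm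
  have hm0 : 0 < m := lt_min hz hw
  have h1 : Integrable (fun s : ℝ => Real.exp (-m * s)) (volume.restrict (Ioi (0:ℝ))) :=
    integrableOn_exp_mul_Ioi (by linarith) 0
  have h2 : Integrable (fun _ : ℝ => ‖w - z‖^2 + ‖w-z‖/2) (volume.restrict (Ioc (0:ℝ) 1)) :=
    integrable_const _
  refine Integrable.mono' (h1.mul_prod h2) ?_ ?_
  · apply Continuous.aestronglyMeasurable
    unfold Dk Function.uncurry
    fun_prop
  · rw [Measure.prod_restrict]
    filter_upwards [ae_restrict_mem (measurableSet_Ioi.prod measurableSet_Ioc)] with p hp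
    obtain ⟨s, t⟩ := p
    obtain ⟨hs, ht⟩ := hp
    simp only [mem_Ioi, mem_Ioc] at hs ht
    simp only [Function.uncurry, Dk]
    rw [norm_mul, mul_comm, Complex.norm_exp]
    apply mul_le_mul
    · apply Real.exp_le_exp.2
      have : (-(z + t * (w - z)) * (s:ℂ)).re = -((z + t * (w - z)).re) * s := by
        rw [← neg_re, re_mul_ofReal]
      rw [this]
      have := seg_re (z := z) (w := w) ⟨ht.1.le, ht.2⟩
      exact mul_le_mul_of_nonneg_right (neg_le_neg this) hs.le
    · refine (norm_sub_le _ _).trans ?_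
      have : ‖(1 - (t:ℂ))‖ ≤ 1 := by
        rw [← ofReal_one, ← ofReal_sub, Complex.norm_real, Real.norm_eq_abs, abs_le]
        constructor <;> linarith
      rw [norm_mul, norm_pow, norm_div]
      have h3 := mul_le_mul_of_nonneg_left this (sq_nonneg ‖w - z‖)
      have h4 : ‖(2:ℂ)‖ = 2 := by simp
      rw [h4]
      linarith
    · positivity
    · positivity

lemma Ek_integrable {z w : ℂ} (hz : 0 < z.re) (hw : 0 < w.re) :
    IntegrableOn (Ek z w) (Ioi 0) := by
  have := (Dk_integrable hz hw).integral_prod_left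
  refine this.congr ?_
  filter_upwards [ae_restrict_mem measurableSet_Ioi] with s hs using Ek_eq z w hs

lemma Ek_integral {z w : ℂ} (hz : 0 < z.re) (hw : 0 < w.re) :
    ∫ s in Ioi (0:ℝ), Ek z w s
      = (w - 1/2) * (Complex.log w - Complex.log z) - (w - z) := by
  have hre : ∀ t ∈ Icc (0:ℝ) 1, 0 < (z + t * (w - z)).re := fun t ht =>
    (lt_min hz hw).trans_le (seg_re ht)
  have hne : ∀ t ∈ Icc (0:ℝ) 1, z + t * (w - z) ≠ 0 := fun t ht h => by
    have := hre t ht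
    rw [h] at this
    simp at this
  have h1 : ∫ s in Ioi (0:ℝ), Ek z w s = ∫ s in Ioi (0:ℝ), ∫ t in Ioc (0:ℝ) 1, Dk z w s t :=
    setIntegral_congr_fun measurableSet_Ioi fun s hs => (Ek_eq z w hs).symm
  rw [h1, integral_integral_swap (Dk_integrable hz hw)]
  have h2 : ∫ t in Ioc (0:ℝ) 1, ∫ s in Ioi (0:ℝ), Dk z w s t =
      ∫ t in Ioc (0:ℝ) 1, ((w - z) / (z + t * (w - z)) * (w - 1/2) - (w - z)) := by
    refine setIntegral_congr_fun measurableSet_Ioc fun t ht => ?_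
    have ht' : t ∈ Icc (0:ℝ) 1 := ⟨ht.1.le, ht.2⟩
    have h0 := hne t ht'
    simp only [Dk]
    rw [integral_const_mul, integral_exp_mul_complex_Ioi (by rw [neg_re]; linarith [hre t ht'])]
    simp only [ofReal_zero, mul_zero, Complex.exp_zero]
    have ha : ∀ a : ℂ, a = z + t * (w - z) → a ≠ 0 →
        ((w - z)^2 * (1 - t) - (w - z)/2) * (-1 / -a) = (w - z) / a * (w - 1/2) - (w - z) := by
      intro a ha h
      field_simp
      rw [ha]
      ring
    exact ha _ rfl h0
  rw [h2, ← intervalIntegral.integral_of_le zero_le_one,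
    intervalIntegral.integral_eq_sub_of_hasDerivAt
      (f := fun t : ℝ => Complex.log (z + t * (w - z)) * (w - 1/2) - t * (w - z))]
  · simp
    ring
  · intro t ht
    rw [uIcc_of_le zero_le_one] at ht
    have hd : HasDerivAt (fun t : ℝ => (t : ℂ)) 1 t := Complex.ofRealCLM.hasDerivAt
    have h3 := (((hd.mul_const (w-z)).const_add z).clog_real (Or.inl (hre t ht))).mul_const (w - 1/2)
    refine (h3.sub (hd.mul_const (w-z))).congr_deriv ?_
    ring
  · apply ContinuousOn.intervalIntegrable
    rw [uIcc_of_le zero_le_one]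
    apply ContinuousOn.sub _ continuousOn_const
    apply ContinuousOn.mul _ continuousOn_const
    exact ContinuousOn.div continuousOn_const (by fun_prop) hne

lemma exp_sub_one_ne {s : ℝ} (hs : 0 < s) : Complex.exp s - 1 ≠ 0 := by
  have : Real.exp s - 1 ≠ 0 := by linarith [Real.add_one_lt_exp hs.ne'] |> ne_of_gt
  exact_mod_cast this

lemma mu_succ {w : ℂ} (hw : 0 < w.re) :
    mu (w + 1) = mu w - ((w + 1/2) * (Complex.log (w+1) - Complex.log w) - 1) := by
  have hw1 : 0 < (w+1).re := by simp; linarith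
  have h := Ek_integral hw hw1
  have h2 : ∫ s in Ioi (0:ℝ), Ek w (w+1) s = mu w - mu (w+1) := by
    unfold mu
    rw [← integral_sub (mu_integrable hw) (mu_integrable hw1)]
    refine setIntegral_congr_fun measurableSet_Ioi fun s hs => ?_
    have hsc : (s : ℂ) ≠ 0 := by exact_mod_cast (ne_of_gt hs)
    have he := exp_sub_one_ne hs
    have e1 : Complex.exp (-(w+1) * s) = Complex.exp (-w * s) / Complex.exp s := by
      rw [← Complex.exp_sub]; congr 1; ring
    have e0 := Complex.exp_ne_zero (s:ℂ)
    simp only [Ek, Bk]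
    push_cast
    rw [e1]
    field_simp
    ring
  rw [h2] at h
  linear_combination -h

/-- Stirling-Binet expression -/
noncomputable def S (w : ℂ) : ℂ :=
  (Real.sqrt (2 * Real.pi) : ℂ) * Complex.exp ((w - 1/2) * Complex.log w - w + mu w)

lemma ne_zero_of_re {w : ℂ} (hw : 0 < w.re) : w ≠ 0 := fun h => by simp [h] at hw

lemma S_succ {w : ℂ} (hw : 0 < w.re) : S (w+1) = w * S w := by
  unfold S
  rw [mu_succ hw]
  have : w = Complex.exp (Complex.log w) := (Complex.exp_log (ne_zero_of_re hw)).symm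
  have h2 : ∀ x : ℂ, w * Complex.exp x = Complex.exp (Complex.log w + x) := by
    intro x
    rw [Complex.exp_add, ← this]
  rw [mul_left_comm, h2]
  congr 2
  ring

lemma S_prod {w : ℂ} (hw : 0 < w.re) (n : ℕ) :
    S (w + n) = (∏ j ∈ Finset.range n, (w + j)) * S w := by
  induction n with
  | zero => simp
  | succ n ih =>
    rw [Finset.prod_range_succ, Nat.cast_succ, ← add_assoc, S_succ (by simp; positivity), ih]
    ring

lemma log_lim {w : ℂ} :
    Tendsto (fun n : ℕ => (w + n + 1/2) * Complex.log (1 + (w+1)/n) - w - 1) atTop (𝓝 0) := by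
  have hn : Tendsto (fun n : ℕ => (w+1)/(n:ℂ)) atTop (𝓝 0) :=
    tendsto_const_div_atTop_nhds_zero_nat (w+1)
  have h1 : Tendsto (fun n : ℕ => (n:ℂ) * Complex.log (1 + (w+1)/n)) atTop (𝓝 (w+1)) := by
    apply Complex.tendsto_nat_mul_log_one_add_of_tendsto
    refine tendsto_const_nhds.congr' ?_
    filter_upwards [eventually_ne_atTop 0] with n hn
    field_simp
  have h2 : Tendsto (fun n : ℕ => Complex.log (1 + (w+1)/n)) atTop (𝓝 0) := by
    have : ContinuousAt (fun x : ℂ => Complex.log (1 + x)) 0 := by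
      apply ContinuousAt.clog (by fun_prop)
      simp
    have := this.tendsto.comp hn
    simpa [Function.comp_def] using this
  have := ((h2.const_mul (w + 1/2)).add h1).sub_const (w+1)
  simp only [mul_zero, zero_add, sub_self] at this
  refine this.congr fun n => ?_
  ring

lemma ratio_eq {w : ℂ} (hw : 0 < w.re) {n : ℕ} (hn : n ≠ 0) :
    S (w + n + 1) / ((n:ℂ)^w * n.factorial) =
      ((Real.sqrt Real.pi / Stirling.stirlingSeq n : ℝ) : ℂ) *
        Complex.exp (((w + n + 1/2) * Complex.log (1 + (w+1)/n) - w - 1) + mu (w + n + 1)) := by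
  have hn0 : (0:ℝ) < n := by positivity
  have hnc : (n:ℂ) ≠ 0 := by exact_mod_cast hn
  have hne : 1 + (w+1)/n ≠ 0 := by
    apply ne_zero_of_re
    have : ((w+1)/(n:ℂ)).re = (w.re+1)/n := by rw [Complex.div_natCast_re]; simp
    rw [add_re, this, one_re]; positivity
  have hlog : Complex.log (w + n + 1) = Complex.log n + Complex.log (1 + (w+1)/n) := by
    have : w + n + 1 = ((n:ℝ):ℂ) * (1 + (w+1)/n) := by push_cast; field_simp; ring
    rw [this, Complex.log_ofReal_mul hn0 hne, Complex.ofReal_log hn0.le]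
    simp
  have hst : (Real.sqrt Real.pi / Stirling.stirlingSeq n : ℝ) =
      Real.sqrt (2 * Real.pi) * Real.exp ((n + 1/2) * Real.log n - n) / n.factorial := by
    unfold Stirling.stirlingSeq
    rw [Real.sqrt_mul (by norm_num), Real.sqrt_mul (by norm_num)]
    have e1 : Real.exp ((n + 1/2) * Real.log n - n) = √n * (n / Real.exp 1)^n := by
      rw [Real.sqrt_eq_rpow, Real.rpow_def_of_pos hn0, div_pow, ← Real.exp_nat_mul,
        ← Real.rpow_natCast, Real.rpow_def_of_pos hn0, ← Real.exp_sub, ← Real.exp_add]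
      congr 1; ring
    rw [e1]
    field_simp
  rw [hst]
  unfold S
  rw [hlog, Complex.cpow_def_of_ne_zero hnc]
  push_cast
  have hf : (n.factorial : ℂ) ≠ 0 := by exact_mod_cast n.factorial_ne_zero
  have he := Complex.exp_ne_zero (Complex.log n * w)
  rw [div_eq_iff (mul_ne_zero he hf)]
  push_cast
  have : ∀ a b c d f q : ℂ, f ≠ 0 → c = a * b * d → q * c = q * a / f * b * (d * f) := by
    intro a b c d f q hf h; rw [h]; field_simp
  apply this _ _ _ _ _ _ hf
  rw [← Complex.exp_add, ← Complex.exp_add]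
  congr 1
  ring

lemma ratio_lim {w : ℂ} (hw : 0 < w.re) :
    Tendsto (fun n : ℕ => S (w + n + 1) / ((n:ℂ)^w * n.factorial)) atTop (𝓝 1) := by
  have hpi : Real.sqrt Real.pi ≠ 0 := by positivity
  have h1 : Tendsto (fun n => Real.sqrt Real.pi / Stirling.stirlingSeq n) atTop (𝓝 1) := by
    have := (tendsto_const_nhds (x := Real.sqrt Real.pi)).div
      Stirling.tendsto_stirlingSeq_sqrt_pi hpi
    rwa [div_self hpi] at this
  have h1' := (Complex.continuous_ofReal.tendsto _).comp h1
  have h2 := (Complex.continuous_exp.tendsto _).comp ((log_lim (w := w)).add (mu_tendsto hw))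
  have h3 := h1'.mul h2
  simp only [add_zero, Complex.exp_zero, ofReal_one, mul_one] at h3
  refine h3.congr' ?_
  filter_upwards [eventually_ne_atTop 0] with n hn
  rw [ratio_eq hw hn]
  rfl

lemma S_eq_Gamma {w : ℂ} (hw : 0 < w.re) : S w = Complex.Gamma w := by
  have h := (ratio_lim hw).mul (Complex.GammaSeq_tendsto_Gamma w)
  rw [one_mul] at h
  refine tendsto_nhds_unique ((tendsto_const_nhds (x := S w)).congr' ?_) h
  filter_upwards [eventually_ne_atTop 0] with n hn
  have hp := S_prod hw (n+1)
  rw [Nat.cast_succ, ← add_assoc] at hp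
  have hP : ∏ j ∈ Finset.range (n+1), (w + j) ≠ 0 := by
    rw [Finset.prod_ne_zero_iff]
    intro j _
    apply ne_zero_of_re
    simp; positivity
  have hnc : (n:ℂ)^w ≠ 0 := by
    rw [Complex.cpow_ne_zero_iff]
    left; exact_mod_cast hn
  have hf : (n.factorial : ℂ) ≠ 0 := by exact_mod_cast n.factorial_ne_zero
  rw [hp, Complex.GammaSeq]
  field_simp

lemma main_integral {z w : ℂ} (hz : 0 < z.re) (hw : 0 < w.re) :
    ∫ s in Ioi (0:ℝ), (1 / (s : ℂ)) *
            ((w - z) - 1 / 2 - 1 / (s : ℂ)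
              + Complex.exp ((1 - (w - z)) * s) / (Complex.exp (s : ℂ) - 1)) *
            Complex.exp (-z * s)
      = (w - 1/2) * (Complex.log w - Complex.log z) - (w - z) + mu w := by
  rw [← Ek_integral hz hw, mu, ← integral_add (Ek_integrable hz hw) (mu_integrable hw)]
  refine setIntegral_congr_fun measurableSet_Ioi fun s hs => ?_
  have hsc : (s : ℂ) ≠ 0 := by exact_mod_cast (ne_of_gt hs)
  have he := exp_sub_one_ne hs
  have e1 : Complex.exp ((1 - (w - z)) * s)
      = Complex.exp s * Complex.exp (-w * s) / Complex.exp (-z * s) := by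
    rw [← Complex.exp_add, ← Complex.exp_sub]; congr 1; ring
  have e0 := Complex.exp_ne_zero (-z * s)
  simp only [Ek, Bk]
  push_cast
  rw [e1]
  generalize Complex.exp (-z * s) = a at *
  field_simp
  ring

end HB

/-- Hermite's generalization of Binet's first formula, exponentiated form: for complex
`z, η` with `Re z > 0` and `Re (z+η) > 0`,
`Γ(z+η) = √(2π) z^{z+η-1/2} exp(-z + ∫_0^∞ (1/s)(η - 1/2 - 1/s + e^{(1-η)s}/(e^s - 1)) e^{-zs} ds)`,
with principal-branch complex powers. -/
theorem gamma_hermite_binet (z η : ℂ) (hz : 0 < z.re) (hzη : 0 < (z + η).re) :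
    Complex.Gamma (z + η)
      = (Real.sqrt (2 * Real.pi) : ℂ) * z ^ (z + η - 1 / 2) *
        Complex.exp (-z + ∫ s in Set.Ioi (0 : ℝ),
          (1 / (s : ℂ)) *
            (η - 1 / 2 - 1 / (s : ℂ)
              + Complex.exp ((1 - η) * s) / (Complex.exp (s : ℂ) - 1)) *
            Complex.exp (-z * s)) := by
  have h := HB.main_integral hz hzη
  simp only [add_sub_cancel_left] at h
  rw [h, ← HB.S_eq_Gamma hzη, HB.S, mul_assoc, Complex.cpow_def_of_ne_zero (HB.ne_zero_of_re hz),
    ← Complex.exp_add]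
  congr 2
  ring
end

section
/- Let z, η be complex numbers with Re z > 0 and Re(z+η) > 0, and define Λ(z,η) = e^z Γ(z+η) / (√(2π) · z^{z+η−1/2}), where Γ is the complex Gamma function and z^{w} denotes the principal branch of the complex power. Then Λ(z,η) = ((z+η)/z)^{z+η−1/2} · exp( −η − ((z+η)/π) ∫_0^∞ log(1 − e^{−2πs}) / (s² + (z+η)²) ds ), where ((z+η)/z)^{w} is the principal branch (well defined since (z+η)/z ∉ (−∞,0] when both z and z+η lie in the open right half-plane). -/
open MeasureTheory Complex Real

namespace BinetAux

/-- The frequency `2π(n+1)`. -/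
noncomputable def fr (n : ℕ) : ℝ := 2 * Real.pi * (n + 1)

lemma fr_pos (n : ℕ) : 0 < fr n := by unfold fr; positivity

/-- Kernel of Binet's first formula, as a Mittag-Leffler series. -/
noncomputable def phi (t : ℝ) : ℝ := ∑' n : ℕ, 2 / (t ^ 2 + fr n ^ 2)

lemma summable_fr : Summable (fun n : ℕ => 2 / fr n ^ 2) := by
  have h := (summable_nat_add_iff 1).mpr (Real.summable_one_div_nat_pow.mpr (one_lt_two))
  have h2 := h.mul_left (2 / (2 * Real.pi) ^ 2)
  refine h2.congr fun n => ?_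
  unfold fr
  push_cast
  field_simp

lemma term_le (t : ℝ) (n : ℕ) : 2 / (t ^ 2 + fr n ^ 2) ≤ 2 / fr n ^ 2 := by
  have := fr_pos n
  gcongr
  nlinarith [sq_nonneg t]

lemma term_nonneg (t : ℝ) (n : ℕ) : 0 ≤ 2 / (t ^ 2 + fr n ^ 2) := by
  positivity

lemma summable_term (t : ℝ) : Summable (fun n : ℕ => 2 / (t ^ 2 + fr n ^ 2)) :=
  Summable.of_nonneg_of_le (term_nonneg t) (term_le t) summable_fr

lemma phi_cont : Continuous phi := by
  unfold phi
  refine continuous_tsum (fun n => ?_) summable_fr (fun n t => ?_)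
  · have := fr_pos n
    refine continuous_const.div (by fun_prop) (fun t => by positivity)
  · rw [Real.norm_of_nonneg (term_nonneg t n)]
    exact term_le t n

lemma phi_nonneg (t : ℝ) : 0 ≤ phi t := tsum_nonneg (term_nonneg t)

lemma phi_le (t : ℝ) : phi t ≤ phi 0 := by
  unfold phi
  refine (summable_term t).tsum_le_tsum (fun n => ?_) (summable_term 0)
  simpa using term_le t n

lemma phi_eq {t : ℝ} (ht : 0 < t) :
    phi t * (1 - Real.exp (-t)) =
      (1 + Real.exp (-t)) / (2 * t) - (1 - Real.exp (-t)) / t ^ 2 := by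
  have hpi : (Real.pi : ℂ) ≠ 0 := by exact_mod_cast Real.pi_ne_zero
  have htc : (t : ℂ) ≠ 0 := by exact_mod_cast ht.ne'
  set z : ℂ := t / (2 * Real.pi) * I with hz
  have him : z.im ≠ 0 := by
    have : z.im = t / (2 * Real.pi) := by
      rw [hz]
      have : (t / (2 * Real.pi) * I : ℂ) = ((t / (2 * Real.pi) : ℝ) : ℂ) * I := by push_cast; ring
      rw [this, Complex.im_ofReal_mul, Complex.I_im, mul_one]
    rw [this]; positivity
  have hzc : z ∈ Complex.integerComplement := by
    rintro ⟨n, hn⟩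
    apply him
    rw [← hn]; simp
  have h := cot_series_rep' hzc
  have hterm : ∀ n : ℕ, (1 / (z - (n + 1)) + 1 / (z + (n + 1)) : ℂ)
      = (-(2 * Real.pi * t) * I) * ((2 / (t ^ 2 + fr n ^ 2) : ℝ) : ℂ) := by
    intro n
    have h1 : z - (n + 1) ≠ 0 := fun hh => him (by
      have := congrArg Complex.im hh; simpa using this)
    have h2 : z + (n + 1) ≠ 0 := fun hh => him (by
      have := congrArg Complex.im hh; simpa using this)
    have h3 : (t ^ 2 + fr n ^ 2 : ℂ) ≠ 0 := by
      have := fr_pos n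
      have : (t ^ 2 + fr n ^ 2 : ℝ) ≠ 0 := by positivity
      exact_mod_cast this
    have h4 : (z - (n + 1)) * (z + (n + 1)) = -((t ^ 2 + fr n ^ 2 : ℂ)) / (2 * Real.pi) ^ 2 := by
      rw [hz]; unfold fr; push_cast; field_simp; 
      ring_nf; simp only [I_sq]; ring
    rw [one_div_add_one_div h1 h2, h4]
    push_cast
    field_simp
    rw [hz]; field_simp; ring
  simp_rw [hterm] at h
  rw [tsum_mul_left, ← Complex.ofReal_tsum] at h
  change _ = _ * (phi t : ℂ) at h
  rw [Complex.cot_pi_eq_exp_ratio] at h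
  have he : (2 * Real.pi * I * z : ℂ) = ((-t : ℝ) : ℂ) := by
    rw [hz]; push_cast; field_simp; simp 
  rw [he, ← Complex.ofReal_exp] at h
  have hlt : Real.exp (-t) < 1 := by rw [Real.exp_lt_one_iff]; linarith
  set e := Real.exp (-t)
  have h5 : (1 - e : ℂ) ≠ 0 := by
    have : (1 - e : ℝ) ≠ 0 := by linarith
    exact_mod_cast this
  rw [hz] at h
  have key : ((phi t * (1 - e) : ℝ) : ℂ) = (((1 + e) / (2 * t) - (1 - e) / t ^ 2 : ℝ) : ℂ) := by
    push_cast
    field_simp at h ⊢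
    ring_nf at h ⊢
    simp only [I_sq] at h
    linear_combination -h
  exact_mod_cast key


lemma exp_int {x : ℝ} (hx : 0 < x) :
    IntegrableOn (fun t : ℝ => Real.exp (-x * t)) (Set.Ioi 0) :=
  integrableOn_exp_mul_Ioi (by linarith) 0

lemma exp_integral {x : ℝ} (hx : 0 < x) :
    ∫ t in Set.Ioi (0 : ℝ), Real.exp (-x * t) = 1 / x := by
  rw [integral_exp_mul_Ioi (by linarith) 0]
  simp

/-- Binet's first integral. -/
noncomputable def F (x : ℝ) : ℝ := ∫ t in Set.Ioi (0 : ℝ), Real.exp (-x * t) * phi t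

lemma F_int {x : ℝ} (hx : 0 < x) :
    IntegrableOn (fun t : ℝ => Real.exp (-x * t) * phi t) (Set.Ioi 0) := by
  refine Integrable.mul_bdd (c := phi 0) (exp_int hx) phi_cont.aestronglyMeasurable
    (Filter.Eventually.of_forall fun t => ?_)
  rw [Real.norm_of_nonneg (phi_nonneg t)]
  exact phi_le t

lemma F_nonneg (x : ℝ) : 0 ≤ F x :=
  integral_nonneg fun t => mul_nonneg (Real.exp_pos _).le (phi_nonneg t)

lemma F_le {x : ℝ} (hx : 0 < x) : F x ≤ phi 0 / x := by
  have : F x ≤ ∫ t in Set.Ioi (0 : ℝ), Real.exp (-x * t) * phi 0 := by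
    refine integral_mono (F_int hx) ((exp_int hx).mul_const _) fun t => ?_
    exact mul_le_mul_of_nonneg_left (phi_le t) (Real.exp_pos _).le
  rw [integral_mul_const, exp_integral hx] at this
  rw [div_eq_mul_one_div, mul_comm]; exact this

lemma inner_int {t : ℝ} (ht : 0 < t) :
    ∫ u in (0 : ℝ)..1, (1 / 2 - u) * Real.exp (-u * t) =
      (1 + Real.exp (-t)) / (2 * t) - (1 - Real.exp (-t)) / t ^ 2 := by
  have h := intervalIntegral.integral_eq_sub_of_hasDerivAt (a := 0) (b := 1)
    (f := fun u => (-(1 / 2 - u) / t + 1 / t ^ 2) * Real.exp (-u * t))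
    (f' := fun u => (1 / 2 - u) * Real.exp (-u * t)) (fun u _ => ?_)
    (Continuous.intervalIntegrable (by fun_prop) _ _)
  · rw [h]; simp; field_simp; ring
  · have h1 : HasDerivAt (fun u : ℝ => -(1 / 2 - u) / t + 1 / t ^ 2) (1 / t) u := by
      have := ((((hasDerivAt_id u).const_sub (1 / 2)).neg).div_const t).add_const (1 / t ^ 2)
      simpa using this
    have h2 : HasDerivAt (fun u : ℝ => Real.exp (-u * t)) (Real.exp (-u * t) * (-1 * t)) u :=
      (((hasDerivAt_id u).neg).mul_const t).exp
    refine (h1.mul h2).congr_deriv ?_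
    field_simp; ring

lemma outer_int {x : ℝ} (hx : 0 < x) :
    ∫ u in (0 : ℝ)..1, (1 / 2 - u) * (1 / (x + u)) =
      (x + 1 / 2) * (Real.log (x + 1) - Real.log x) - 1 := by
  have h := intervalIntegral.integral_eq_sub_of_hasDerivAt (a := 0) (b := 1)
    (f := fun u => (x + 1 / 2) * Real.log (x + u) - u)
    (f' := fun u => (1 / 2 - u) * (1 / (x + u))) (fun u hu => ?_) ?_
  · rw [h]; simp; ring
  · have hu : 0 ≤ u := by rw [Set.uIcc_of_le zero_le_one] at hu; exact hu.1
    have h0 : x + u ≠ 0 := by positivity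
    have h1 := ((((hasDerivAt_id u).const_add x).log h0).const_mul (x + 1 / 2)).sub (hasDerivAt_id u)
    refine HasDerivAt.congr_deriv h1 ?_
    simp only [id]
    field_simp; ring
  · refine ContinuousOn.intervalIntegrable ?_
    refine ContinuousOn.mul (by fun_prop) (continuousOn_const.div (by fun_prop) fun u hu => ?_)
    rw [Set.uIcc_of_le zero_le_one] at hu
    have := hu.1
    positivity

lemma F_feq {x : ℝ} (hx : 0 < x) :
    F x - F (x + 1) = (x + 1 / 2) * (Real.log (x + 1) - Real.log x) - 1 := by
  rw [← outer_int hx]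
  unfold F
  rw [← integral_sub (F_int hx) (F_int (by linarith))]
  have h1 : ∫ t in Set.Ioi (0 : ℝ), (Real.exp (-x * t) * phi t - Real.exp (-(x + 1) * t) * phi t)
      = ∫ t in Set.Ioi (0 : ℝ), ∫ u in Set.Ioc (0 : ℝ) 1,
          (1 / 2 - u) * Real.exp (-(x + u) * t) := by
    refine setIntegral_congr_fun measurableSet_Ioi fun t ht => ?_
    have e1 : Real.exp (-(x + 1) * t) = Real.exp (-x * t) * Real.exp (-t) := by
      rw [← Real.exp_add]; ring_nf
    have e2 : ∀ u, (1 / 2 - u) * Real.exp (-(x + u) * t)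
        = Real.exp (-x * t) * ((1 / 2 - u) * Real.exp (-u * t)) := by
      intro u
      rw [show -(x + u) * t = -x * t + -u * t by ring, Real.exp_add]; ring
    simp only [e2]
    rw [integral_const_mul, ← intervalIntegral.integral_of_le zero_le_one, inner_int ht,
      ← phi_eq ht, e1]
    ring
  rw [h1, integral_integral_swap, intervalIntegral.integral_of_le zero_le_one]
  · refine setIntegral_congr_fun measurableSet_Ioc fun u hu => ?_
    rw [integral_const_mul, exp_integral (by linarith [hu.1])]
  · have hb : Integrable (fun p : ℝ × ℝ => Real.exp (-x * p.1))
        ((volume.restrict (Set.Ioi 0)).prod (volume.restrict (Set.Ioc 0 1))) :=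
      Integrable.comp_fst (exp_int hx) _
    refine hb.mono' (Continuous.aestronglyMeasurable (by unfold Function.uncurry; fun_prop)) ?_
    rw [Measure.prod_restrict]
    refine (ae_restrict_iff' (measurableSet_Ioi.prod measurableSet_Ioc)).mpr
      (Filter.Eventually.of_forall ?_)
    rintro ⟨t, u⟩ ⟨ht, hu⟩
    simp only [Set.mem_Ioi, Set.mem_Ioc] at ht hu
    simp only [Function.uncurry, norm_mul, Real.norm_eq_abs, Real.abs_exp]
    have a1 : |1 / 2 - u| ≤ 1 := by rw [abs_le]; constructor <;> linarith
    have a2 : Real.exp (-(x + u) * t) ≤ Real.exp (-x * t) := by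
      apply Real.exp_le_exp.mpr; nlinarith [mul_pos hu.1 ht]
    calc _ ≤ 1 * Real.exp (-(x + u) * t) := by gcongr
      _ ≤ _ := by linarith

lemma F_convex : ConvexOn ℝ (Set.Ioi 0) F := by
  refine ⟨convex_Ioi 0, fun x hx y hy a b ha hb hab => ?_⟩
  have hxy : 0 < a * x + b * y := (convex_Ioi (0 : ℝ)) hx hy ha hb hab
  simp only [smul_eq_mul]
  unfold F
  rw [← integral_const_mul, ← integral_const_mul,
    ← integral_add ((F_int hx).const_mul a) ((F_int hy).const_mul b)]
  refine integral_mono (F_int hxy) (((F_int hx).const_mul a).add ((F_int hy).const_mul b))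
    fun t => ?_
  have h := convexOn_exp.2 (Set.mem_univ (-x * t)) (Set.mem_univ (-y * t)) ha hb hab
  simp only [smul_eq_mul] at h
  have h2 := mul_le_mul_of_nonneg_right h (phi_nonneg t)
  rw [show -(a * x + b * y) * t = a * (-x * t) + b * (-y * t) by ring]
  simp only [Pi.add_apply]
  linarith

/-- Logarithm of the Binet right-hand side. -/
noncomputable def f (x : ℝ) : ℝ :=
  (x - 1 / 2) * Real.log x - x + Real.log (2 * Real.pi) / 2 + F x

lemma f_convex : ConvexOn ℝ (Set.Ioi 0) f := by
  have h1 : ConvexOn ℝ (Set.Ioi 0) (fun x : ℝ => x * Real.log x) :=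
    Real.convexOn_mul_log.subset (Set.Ioi_subset_Ici le_rfl) (convex_Ioi 0)
  have h2 : ConvexOn ℝ (Set.Ioi 0) (fun x : ℝ => - Real.log x) :=
    strictConcaveOn_log_Ioi.concaveOn.neg
  have h3 : ConvexOn ℝ (Set.Ioi 0) (fun x : ℝ => -x) :=
    (concaveOn_id (convex_Ioi 0)).neg
  have h4 : ConvexOn ℝ (Set.Ioi (0:ℝ)) (fun _ : ℝ => Real.log (2 * Real.pi) / 2) :=
    convexOn_const _ (convex_Ioi 0)
  have h := (((h1.add (h2.smul (c := 1 / 2) (by norm_num))).add h3).add h4).add F_convex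
  refine h.congr fun x _ => ?_
  simp only [Pi.add_apply, smul_eq_mul, f]
  ring

lemma f_feq {y : ℝ} (hy : 0 < y) : f (y + 1) = f y + Real.log y := by
  have := F_feq hy
  unfold f
  linarith

lemma F_nat_tendsto : Filter.Tendsto (fun n : ℕ => F n) Filter.atTop (nhds 0) := by
  refine squeeze_zero' (g := fun n : ℕ => phi 0 / n) (Filter.Eventually.of_forall fun n => F_nonneg _) ?_
    (tendsto_const_div_atTop_nhds_zero_nat _)
  filter_upwards [Filter.eventually_gt_atTop 0] with n hn
  exact F_le (by exact_mod_cast hn)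

lemma f_eq {x : ℝ} (hx : 0 < x) : f x = Real.log (Real.Gamma x) := by
  have hmain : ∀ {x : ℝ}, 0 < x → f x - f 1 = Real.log (Real.Gamma x) := fun {x} hx =>
    tendsto_nhds_unique (Real.BohrMollerup.tendsto_logGammaSeq f_convex f_feq hx)
      (Real.BohrMollerup.tendsto_log_gamma hx)
  suffices f 1 = 0 by have := hmain hx; linarith
  have hs : Filter.Tendsto (fun n => Real.log (Stirling.stirlingSeq n)) Filter.atTop
      (nhds (Real.log (Real.sqrt Real.pi))) :=
    Stirling.tendsto_stirlingSeq_sqrt_pi.log (by positivity)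
  have hs2 : Filter.Tendsto (fun n => Real.log (Stirling.stirlingSeq n)) Filter.atTop
      (nhds (Real.log Real.pi / 2 + 0 - f 1)) := by
    have h : Filter.Tendsto (fun n : ℕ => Real.log Real.pi / 2 + F n - f 1) Filter.atTop
      (nhds (Real.log Real.pi / 2 + 0 - f 1)) := (F_nat_tendsto.const_add _).sub_const _
    refine h.congr' ?_
    filter_upwards [Filter.eventually_gt_atTop 0] with n hn
    have hn' : (0 : ℝ) < n := by exact_mod_cast hn
    have h1 := hmain (show (0 : ℝ) < n + 1 by positivity)
    rw [Real.Gamma_nat_eq_factorial, f_feq hn'] at h1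
    rw [Stirling.log_stirlingSeq_formula, ← h1, Real.log_mul (by norm_num) hn'.ne',
      Real.log_div hn'.ne' (Real.exp_pos 1).ne', Real.log_exp]
    unfold f
    rw [Real.log_mul (by norm_num) Real.pi_ne_zero]
    ring
  have := tendsto_nhds_unique hs hs2
  rw [Real.log_sqrt Real.pi_pos.le] at this
  linarith


lemma F_hasSum {x : ℝ} (hx : 0 < x) :
    HasSum (fun n : ℕ => ∫ t in Set.Ioi (0 : ℝ), Real.exp (-x * t) * (2 / (t ^ 2 + fr n ^ 2)))
      (F x) := by
  have hint : ∀ n : ℕ, IntegrableOn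
      (fun t : ℝ => Real.exp (-x * t) * (2 / (t ^ 2 + fr n ^ 2))) (Set.Ioi 0) := by
    intro n
    have hc : Continuous (fun t : ℝ => 2 / (t ^ 2 + fr n ^ 2)) := by
      have := fr_pos n
      exact continuous_const.div (by fun_prop) (fun t => by positivity)
    refine Integrable.mul_bdd (c := 2 / fr n ^ 2) (exp_int hx) hc.aestronglyMeasurable
      (Filter.Eventually.of_forall fun t => ?_)
    rw [Real.norm_of_nonneg (term_nonneg t n)]
    exact term_le t n
  have h := hasSum_integral_of_summable_integral_norm hint ?_
  · simp_rw [tsum_mul_left] at h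
    exact h
  · refine Summable.of_nonneg_of_le (fun n => integral_nonneg fun t => norm_nonneg _) (fun n => ?_)
      (summable_fr.mul_left (1 / x))
    rw [← exp_integral hx, ← integral_mul_const]
    refine integral_mono (hint n).norm ((exp_int hx).mul_const _) fun t => ?_
    simp only
    rw [Real.norm_of_nonneg (mul_nonneg (Real.exp_pos _).le (term_nonneg t n))]
    exact mul_le_mul_of_nonneg_left (term_le t n) (Real.exp_pos _).le

lemma scale {x : ℝ} (hx : 0 < x) (n : ℕ) :
    ∫ s in Set.Ioi (0 : ℝ), x / Real.pi * (Real.exp (-fr n * s) / (n + 1) * (1 / (s ^ 2 + x ^ 2)))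
      = ∫ t in Set.Ioi (0 : ℝ), Real.exp (-x * t) * (2 / (t ^ 2 + fr n ^ 2)) := by
  have hf := fr_pos n
  have h := integral_comp_mul_left_Ioi' (fun s : ℝ =>
    x / Real.pi * (Real.exp (-fr n * s) / (n + 1) * (1 / (s ^ 2 + x ^ 2)))) 0
    (b := x / fr n) (by positivity)
  rw [mul_zero] at h
  rw [← h, smul_eq_mul, ← integral_const_mul]
  congr 1
  ext t
  rw [show -fr n * (x / fr n * t) = -x * t by field_simp]
  have e : fr n = 2 * Real.pi * (n + 1) := rfl
  have h1 : (x / fr n * t) ^ 2 + x ^ 2 = x ^ 2 * (t ^ 2 + fr n ^ 2) / fr n ^ 2 := by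
    field_simp
  rw [h1]
  have h2 : t ^ 2 + fr n ^ 2 ≠ 0 := by positivity
  field_simp
  rw [e]; ring

lemma log_hasSum {s : ℝ} (hs : 0 < s) :
    HasSum (fun n : ℕ => Real.exp (-fr n * s) / (n + 1))
      (-Real.log (1 - Real.exp (-2 * Real.pi * s))) := by
  have hlt : Real.exp (-2 * Real.pi * s) < 1 := by
    rw [Real.exp_lt_one_iff]; nlinarith [mul_pos Real.pi_pos hs]
  have h := Real.hasSum_pow_div_log_of_abs_lt_one
    (x := Real.exp (-2 * Real.pi * s)) (by rwa [Real.abs_exp])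
  refine h.congr_fun ?_ |> fun h => h
  intro n
  rw [← Real.exp_nat_mul]
  unfold fr
  push_cast
  ring_nf

lemma F_eq {x : ℝ} (hx : 0 < x) :
    F x = -(x / Real.pi * ∫ s in Set.Ioi (0 : ℝ),
      Real.log (1 - Real.exp (-2 * Real.pi * s)) / (s ^ 2 + x ^ 2)) := by
  have hc : Continuous (fun s : ℝ => 1 / (s ^ 2 + x ^ 2)) :=
    continuous_const.div (by fun_prop) (fun t => by positivity)
  have hint : ∀ n : ℕ, IntegrableOn (fun s : ℝ =>
      x / Real.pi * (Real.exp (-fr n * s) / (n + 1) * (1 / (s ^ 2 + x ^ 2)))) (Set.Ioi 0) := by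
    intro n
    refine Integrable.const_mul ?_ _
    refine Integrable.mul_bdd (c := 1 / x ^ 2) ((exp_int (fr_pos n)).div_const _)
      hc.aestronglyMeasurable (Filter.Eventually.of_forall fun t => ?_)
    rw [Real.norm_of_nonneg (by positivity)]
    gcongr
    nlinarith [sq_nonneg t]
  have h := hasSum_integral_of_summable_integral_norm hint ?_
  · simp_rw [scale hx] at h
    rw [(F_hasSum hx).unique h, ← integral_const_mul, ← integral_neg]
    refine setIntegral_congr_fun measurableSet_Ioi fun s hs => ?_
    rw [tsum_mul_left, tsum_mul_right, (log_hasSum hs).tsum_eq]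
    ring
  · refine (F_hasSum hx).summable.congr fun n => ?_
    rw [← scale hx n]
    congr 1
    ext s
    rw [Real.norm_of_nonneg (by positivity)]

lemma log_int : IntegrableOn (fun s : ℝ => Real.log (1 - Real.exp (-2 * Real.pi * s)))
    (Set.Ioi 0) := by
  have hval : ∀ n : ℕ, ∫ s in Set.Ioi (0 : ℝ), Real.exp (-fr n * s) / (n + 1) =
      Real.pi * (2 / fr n ^ 2) := by
    intro n
    rw [integral_div, exp_integral (fr_pos n)]
    unfold fr
    field_simp
  have h := hasSum_integral_of_summable_integral_norm
    (μ := volume.restrict (Set.Ioi (0 : ℝ)))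
    (F := fun (n : ℕ) (s : ℝ) => Real.exp (-fr n * s) / (n + 1))
    (fun n => (exp_int (fr_pos n)).div_const _) ?_
  · simp_rw [hval] at h
    have h2 : ∫ s in Set.Ioi (0 : ℝ), ∑' n : ℕ, Real.exp (-fr n * s) / (n + 1) =
        ∫ s in Set.Ioi (0 : ℝ), -Real.log (1 - Real.exp (-2 * Real.pi * s)) :=
      setIntegral_congr_fun measurableSet_Ioi fun s hs => (log_hasSum hs).tsum_eq
    rw [h2] at h
    have hpos : 0 < ∫ s in Set.Ioi (0 : ℝ), -Real.log (1 - Real.exp (-2 * Real.pi * s)) := by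
      rw [← h.tsum_eq]
      refine h.summable.tsum_pos (fun n => by positivity) 0 ?_
      have := fr_pos 0
      positivity
    have hi : Integrable (fun s : ℝ => -Real.log (1 - Real.exp (-2 * Real.pi * s)))
        (volume.restrict (Set.Ioi (0 : ℝ))) := by
      by_contra hn
      rw [integral_undef hn] at hpos
      exact lt_irrefl _ hpos
    exact hi.neg.congr (Filter.Eventually.of_forall fun s => neg_neg _)
  · refine (summable_fr.mul_left Real.pi).congr fun n => ?_
    rw [← hval n]
    congr 1
    ext s
    rw [Real.norm_of_nonneg (by positivity)]

/-- The complex Binet integral. -/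
noncomputable def J (w : ℂ) : ℂ := ∫ s in Set.Ioi (0 : ℝ),
  (Real.log (1 - Real.exp (-2 * Real.pi * s)) : ℂ) / ((s : ℂ) ^ 2 + w ^ 2)

lemma sq_bound {w : ℂ} (hw : 0 < w.re) (s : ℝ) : w.re ^ 2 ≤ ‖(s : ℂ) ^ 2 + w ^ 2‖ := by
  have h : (s : ℂ) ^ 2 + w ^ 2 = (w + s * I) * (w - s * I) := by
    ring_nf; simp only [I_sq]; ring
  rw [h, norm_mul, sq]
  have h1 := (Complex.abs_re_le_norm (w + s * I))
  have h2 := (Complex.abs_re_le_norm (w - s * I))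
  simp only [Complex.add_re, Complex.sub_re, Complex.mul_re, Complex.ofReal_re, Complex.I_re,
    Complex.ofReal_im, Complex.I_im, mul_zero, zero_mul, sub_zero, add_zero, abs_of_pos hw] at h1 h2
  exact mul_le_mul h1 h2 hw.le (norm_nonneg _)

lemma J_diff {w : ℂ} (hw : 0 < w.re) : DifferentiableAt ℂ J w := by
  set r := w.re / 2 with hr
  have hr0 : 0 < r := by positivity
  have hball : ∀ v ∈ Metric.ball w r, r < v.re ∧ ‖v‖ ≤ ‖w‖ + r := by
    intro v hv
    rw [mem_ball_iff_norm] at hv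
    have h1 := (Complex.abs_re_le_norm (v - w)).trans_lt hv
    rw [abs_lt, Complex.sub_re] at h1
    refine ⟨by linarith [h1.1], ?_⟩
    have := norm_add_le w (v - w)
    rw [add_sub_cancel] at this
    linarith
  have hmeas : ∀ v : ℂ, AEStronglyMeasurable (fun s : ℝ =>
      (Real.log (1 - Real.exp (-2 * Real.pi * s)) : ℂ) / ((s : ℂ) ^ 2 + v ^ 2))
      (volume.restrict (Set.Ioi (0 : ℝ))) := by
    intro v
    exact Measurable.aestronglyMeasurable (by fun_prop)
  have key := hasDerivAt_integral_of_dominated_loc_of_deriv_le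
    (μ := volume.restrict (Set.Ioi (0 : ℝ))) (𝕜 := ℂ) (x₀ := w) (s := Metric.ball w r)
    (F := fun v s => (Real.log (1 - Real.exp (-2 * Real.pi * s)) : ℂ) / ((s : ℂ) ^ 2 + v ^ 2))
    (F' := fun v s => (Real.log (1 - Real.exp (-2 * Real.pi * s)) : ℂ) *
      (-(2 * v) / ((s : ℂ) ^ 2 + v ^ 2) ^ 2))
    (bound := fun s => |Real.log (1 - Real.exp (-2 * Real.pi * s))| *
      (2 * (‖w‖ + r) / (r ^ 2) ^ 2))
    (Metric.ball_mem_nhds w hr0) (Filter.Eventually.of_forall hmeas) ?_ ?_ ?_ ?_ ?_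
  · exact key.2.differentiableAt
  · refine Integrable.mono' (log_int.abs.mul_const (1 / w.re ^ 2)) (hmeas w)
      (Filter.Eventually.of_forall fun s => ?_)
    rw [norm_div, Complex.norm_real, Real.norm_eq_abs, div_eq_mul_one_div]
    gcongr
    exact sq_bound hw s
  · exact Measurable.aestronglyMeasurable (by fun_prop)
  · refine Filter.Eventually.of_forall fun s v hv => ?_
    obtain ⟨h1, h2⟩ := hball v hv
    have h3 := sq_bound (hr0.trans h1) s
    rw [norm_mul, Complex.norm_real, Real.norm_eq_abs, norm_div, norm_neg, norm_mul, norm_pow]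
    simp only [Complex.norm_ofNat]
    have h4 : r ^ 2 ≤ ‖(s : ℂ) ^ 2 + v ^ 2‖ := le_trans (by gcongr) h3
    gcongr
  · exact log_int.abs.mul_const _
  · refine Filter.Eventually.of_forall fun s v hv => ?_
    obtain ⟨h1, h2⟩ := hball v hv
    have h3 := sq_bound (hr0.trans h1) s
    have h4 : (s : ℂ) ^ 2 + v ^ 2 ≠ 0 := by
      rw [← norm_pos_iff]
      have : 0 < v.re := hr0.trans h1
      exact lt_of_lt_of_le (by positivity) h3
    have h5 : HasDerivAt (fun v : ℂ => (s : ℂ) ^ 2 + v ^ 2) (2 * v) v := by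
      simpa using (hasDerivAt_pow 2 v).const_add ((s : ℂ) ^ 2)
    have h6 := (h5.inv h4).const_mul (Real.log (1 - Real.exp (-2 * Real.pi * s)) : ℂ)
    simp only [div_eq_mul_inv] at h6 ⊢
    exact h6

/-- The complex Binet right-hand side for `Γ`. -/
noncomputable def R (w : ℂ) : ℂ := (Real.sqrt (2 * Real.pi) : ℂ) *
  Complex.exp ((w - 1 / 2) * Complex.log w - w - w / (Real.pi : ℂ) * J w)

lemma R_real {x : ℝ} (hx : 0 < x) : Complex.Gamma x = R x := by
  have hJ : J x = ((∫ s in Set.Ioi (0 : ℝ),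
      Real.log (1 - Real.exp (-2 * Real.pi * s)) / (s ^ 2 + x ^ 2) : ℝ) : ℂ) := by
    unfold J
    rw [← integral_complex_ofReal]
    push_cast
    rfl
  have h := f_eq hx
  have h2 : Real.Gamma x = Real.sqrt (2 * Real.pi) * Real.exp ((x - 1 / 2) * Real.log x - x -
      x / Real.pi * ∫ s in Set.Ioi (0 : ℝ),
      Real.log (1 - Real.exp (-2 * Real.pi * s)) / (s ^ 2 + x ^ 2)) := by
    rw [← Real.exp_log (Real.Gamma_pos_of_pos hx), ← h]
    have h3 : Real.sqrt (2 * Real.pi) = Real.exp (Real.log (2 * Real.pi) / 2) := by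
      rw [← Real.log_sqrt (by positivity), Real.exp_log (by positivity)]
    rw [h3, ← Real.exp_add]
    unfold f
    rw [F_eq hx]
    congr 1
    ring
  rw [Complex.Gamma_ofReal, h2]
  unfold R
  rw [hJ, ← Complex.ofReal_log hx.le]
  push_cast
  rfl

lemma Gamma_eq {w : ℂ} (hw : 0 < w.re) : Complex.Gamma w = R w := by
  have hopen : IsOpen {w : ℂ | 0 < w.re} := isOpen_lt continuous_const Complex.continuous_re
  have hG : AnalyticOnNhd ℂ Complex.Gamma {w : ℂ | 0 < w.re} := by
    refine DifferentiableOn.analyticOnNhd (fun v hv => ?_) hopen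
    refine (Complex.differentiableAt_Gamma v fun m hm => ?_).differentiableWithinAt
    have : v.re = -m := by rw [hm]; simp
    have hv' : 0 < v.re := hv
    have : (0 : ℝ) ≤ m := Nat.cast_nonneg m
    linarith
  have hR : AnalyticOnNhd ℂ R {w : ℂ | 0 < w.re} := by
    refine DifferentiableOn.analyticOnNhd (fun v hv => ?_) hopen
    refine DifferentiableAt.differentiableWithinAt ?_
    have h1 := J_diff (w := v) hv
    have h2 : DifferentiableAt ℂ Complex.log v := Complex.differentiableAt_log (Or.inl hv)
    unfold R
    fun_prop
  refine hG.eqOn_of_preconnected_of_frequently_eq hR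
    (convex_halfSpace_re_gt 0).isPreconnected (z₀ := 1) (by simp) ?_ hw
  have ht : Filter.Tendsto (fun x : ℝ => (x : ℂ)) (nhdsWithin 1 {1}ᶜ) (nhdsWithin 1 {1}ᶜ) := by
    refine tendsto_nhdsWithin_iff.mpr ⟨?_, ?_⟩
    · exact (Complex.continuous_ofReal.tendsto' 1 1 (by simp)).mono_left nhdsWithin_le_nhds
    · filter_upwards [self_mem_nhdsWithin] with x hx
      simpa using hx
  refine ht.frequently (Filter.Eventually.frequently ?_)
  filter_upwards [mem_nhdsWithin_of_mem_nhds (Ioi_mem_nhds (show (0:ℝ) < 1 by norm_num))] with x hx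
  exact R_real hx

lemma log_div' {z w : ℂ} (hz : 0 < z.re) (hw : 0 < w.re) :
    Complex.log (w / z) = Complex.log w - Complex.log z := by
  have hz0 : z ≠ 0 := by rintro rfl; simp at hz
  have hw0 : w ≠ 0 := by rintro rfl; simp at hw
  have az := abs_lt.mp (Complex.abs_arg_lt_pi_div_two_iff.mpr (Or.inl hz))
  have aw := abs_lt.mp (Complex.abs_arg_lt_pi_div_two_iff.mpr (Or.inl hw))
  rw [← Complex.exp_log hz0, ← Complex.exp_log hw0, ← Complex.exp_sub, Complex.log_exp,
    Complex.exp_log hz0, Complex.exp_log hw0]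
  all_goals
    simp only [Complex.exp_log hz0, Complex.exp_log hw0, Complex.sub_im, Complex.log_im]
    linarith [az.1, az.2, aw.1, aw.2]

end BinetAux

theorem generalizedGamma_second_binet (z η : ℂ) (hz : 0 < z.re) (hzη : 0 < (z + η).re) :
    Complex.exp z * Complex.Gamma (z + η)
        / ((Real.sqrt (2 * Real.pi) : ℂ) * z ^ (z + η - 1 / 2))
      = ((z + η) / z) ^ (z + η - 1 / 2) *
        Complex.exp (-η - ((z + η) / (Real.pi : ℂ)) *
          ∫ s in Set.Ioi (0 : ℝ),
            (Real.log (1 - Real.exp (-2 * Real.pi * s)) : ℂ)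
              / ((s : ℂ) ^ 2 + (z + η) ^ 2)) := by

  have hz0 : z ≠ 0 := by rintro rfl; simp at hz
  have hw0 : z + η ≠ 0 := by intro h; rw [h] at hzη; simp at hzη
  have hdiv : (z + η) / z ≠ 0 := div_ne_zero hw0 hz0
  rw [BinetAux.Gamma_eq hzη]
  change _ = _ * Complex.exp (-η - ((z + η) / (Real.pi : ℂ)) * BinetAux.J (z + η))
  unfold BinetAux.R
  have hs : (Real.sqrt (2 * Real.pi) : ℂ) ≠ 0 := by
    have : Real.sqrt (2 * Real.pi) ≠ 0 := by positivity
    exact_mod_cast this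
  rw [Complex.cpow_def_of_ne_zero hz0, Complex.cpow_def_of_ne_zero hdiv,
    BinetAux.log_div' hz hzη, mul_left_comm, mul_div_mul_left _ _ hs, ← Complex.exp_add,
    ← Complex.exp_sub, ← Complex.exp_add]
  congr 1
  ring
end

section
/- Let z, η be complex numbers with Re z > 0 and Re(z+η) > 0. Then ∫_0^∞ (1/s) [ ( 1/s² − 1/12 ) e^{−(z+η)s} − ( 1/s² − η/s + η²/2 − 1/12 ) e^{−zs} ] ds = (3η²)/4 + (zη)/2 − (1/2) ( (z+η)² − 1/6 ) ( log(z+η) − log z ), where log denotes the principal branch of the complex logarithm. -/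
open MeasureTheory Complex

open Filter Topology in
lemma aux_taylor (w : ℂ) :
    Tendsto (fun s : ℝ => (Complex.exp (-w * s) - (1 - w * s + (w * s) ^ 2 / 2)) / (s : ℂ) ^ 2)
      (𝓝[>] 0) (𝓝 0) := by
  have hb : Tendsto (fun s : ℝ => ‖w‖ ^ 3 * s * Real.exp (‖w‖ * s)) (𝓝[>] 0) (𝓝 0) := by
    have : Continuous (fun s : ℝ => ‖w‖ ^ 3 * s * Real.exp (‖w‖ * s)) := by fun_prop
    have h := this.tendsto 0
    simp only [mul_zero, zero_mul] at h
    exact h.mono_left nhdsWithin_le_nhds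
  refine squeeze_zero_norm' ?_ hb
  filter_upwards [self_mem_nhdsWithin] with s hs
  have hs : 0 < s := hs
  have h := Complex.norm_exp_sub_sum_le_norm_mul_exp (-w * s) 3
  simp [Finset.sum_range_succ, Nat.factorial] at h
  rw [norm_div, norm_pow, Complex.norm_real, Real.norm_of_nonneg hs.le, div_le_iff₀ (by positivity)]
  rw [abs_of_pos hs] at h
  calc _ = ‖cexp (-(w * s)) - (1 + -(w * s) + (w * s) ^ 2 / 2)‖ := by
        congr 1; ring_nf
    _ ≤ _ := h
    _ = _ := by ring

lemma aux_re (z η : ℂ) (hz : 0 < z.re) (hzη : 0 < (z + η).re) :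
    ∃ m : ℝ, 0 < m ∧ ∀ t ∈ Set.Icc (0:ℝ) 1, m ≤ (z + t * η).re := by
  refine ⟨min z.re (z + η).re, lt_min hz hzη, fun t ht => ?_⟩
  have h1 := min_le_left z.re (z + η).re
  have h2 := min_le_right z.re (z + η).re
  generalize min z.re (z + η).re = m at *
  simp only [add_re, re_ofReal_mul] at h2 ⊢
  nlinarith [ht.1, ht.2]

lemma aux_prod (z η : ℂ) (hz : 0 < z.re) (hzη : 0 < (z + η).re) :
    Integrable (Function.uncurry fun (t s : ℝ) => η * Complex.exp (-(z + t * η) * s))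
      ((volume.restrict (Set.uIoc (0:ℝ) 1)).prod (volume.restrict (Set.Ioi (0:ℝ)))) := by
  obtain ⟨m, hm, h⟩ := aux_re z η hz hzη
  have h1 : Integrable (fun _ : ℝ => ‖η‖) (volume.restrict (Set.uIoc (0:ℝ) 1)) := by
    rw [Set.uIoc_of_le zero_le_one]
    exact integrable_const _
  have h2 := h1.mul_prod (exp_neg_integrableOn_Ioi 0 hm)
  refine h2.mono' (Continuous.aestronglyMeasurable (by
    unfold Function.uncurry; fun_prop)) ?_
  rw [Measure.prod_restrict]
  refine (ae_restrict_iff' (by measurability)).2 (Filter.Eventually.of_forall ?_)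
  rintro ⟨t, s⟩ ⟨ht, hs⟩
  rw [Set.uIoc_of_le zero_le_one] at ht
  have hs : 0 < s := hs
  have := h t ⟨ht.1.le, ht.2⟩
  simp only [Function.uncurry, norm_mul, Complex.norm_exp]
  gcongr
  simp only [neg_mul, neg_re, re_mul_ofReal]
  gcongr

lemma aux_inner (z η : ℂ) (s : ℝ) (hs : 0 < s) :
    ∫ t in (0:ℝ)..1, η * Complex.exp (-(z + t * η) * s)
      = - ((Complex.exp (-(z + η) * s) - Complex.exp (-z * s)) / s) := by
  have hs' : (s : ℂ) ≠ 0 := by exact_mod_cast hs.ne'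
  have := intervalIntegral.integral_eq_sub_of_hasDerivAt (a := 0) (b := 1)
    (f := fun t : ℝ => - Complex.exp (-(z + t * η) * s) / s)
    (f' := fun t : ℝ => η * Complex.exp (-(z + t * η) * s)) ?_ ?_
  · rw [this]; simp; ring
  · intro t _
    have h0 : HasDerivAt (fun t : ℝ => (t : ℂ)) 1 t := Complex.ofRealCLM.hasDerivAt
    have h1 := ((((((h0.mul_const η).const_add z).neg).mul_const (s:ℂ)).cexp).neg).div_const (s:ℂ)
    refine h1.congr_deriv ?_
    simp only [Pi.neg_apply]
    field_simp
  · apply Continuous.intervalIntegrable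
    fun_prop

lemma aux_frullani_int (z η : ℂ) (hz : 0 < z.re) (hzη : 0 < (z + η).re) :
    IntegrableOn (fun s : ℝ => (Complex.exp (-(z + η) * s) - Complex.exp (-z * s)) / s)
      (Set.Ioi (0:ℝ)) := by
  have h := (aux_prod z η hz hzη).integral_prod_right.neg
  refine IntegrableOn.congr_fun h (fun s hs => ?_) measurableSet_Ioi
  have := aux_inner z η s hs
  rw [intervalIntegral.integral_of_le zero_le_one] at this
  simp [Function.uncurry] at this ⊢
  rw [this]; simp

lemma aux_frullani (z η : ℂ) (hz : 0 < z.re) (hzη : 0 < (z + η).re) :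
    ∫ s in Set.Ioi (0:ℝ), (Complex.exp (-(z + η) * s) - Complex.exp (-z * s)) / (s:ℂ)
      = - (Complex.log (z + η) - Complex.log z) := by
  obtain ⟨m, hm, h⟩ := aux_re z η hz hzη
  have h1 := intervalIntegral_integral_swap (aux_prod z η hz hzη)
  have h2 : ∫ s in Set.Ioi (0:ℝ), (∫ t in (0:ℝ)..1, η * Complex.exp (-(z + t * η) * s))
      = - ∫ s in Set.Ioi (0:ℝ), (Complex.exp (-(z + η) * s) - Complex.exp (-z * s)) / (s:ℂ) := by
    rw [← integral_neg]
    exact setIntegral_congr_fun measurableSet_Ioi (fun s hs => aux_inner z η s hs)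
  have h3 : ∫ t in (0:ℝ)..1, (∫ s in Set.Ioi (0:ℝ), η * Complex.exp (-(z + t * η) * s))
      = ∫ t in (0:ℝ)..1, η / (z + t * η) := by
    apply intervalIntegral.integral_congr
    intro t ht
    rw [Set.uIcc_of_le zero_le_one] at ht
    have := h t ht
    simp only
    rw [integral_const_mul, integral_exp_mul_complex_Ioi (by rw [neg_re]; linarith)]
    simp [div_eq_mul_inv, -neg_add_rev]
  have h4 : ∫ t in (0:ℝ)..1, η / (z + t * η) = Complex.log (z + η) - Complex.log z := by
    have hne : ∀ t ∈ Set.uIcc (0:ℝ) 1, z + t * η ∈ slitPlane := by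
      intro t ht
      rw [Set.uIcc_of_le zero_le_one] at ht
      exact Or.inl (hm.trans_le (h t ht))
    have := intervalIntegral.integral_eq_sub_of_hasDerivAt (a := 0) (b := 1)
      (f := fun t : ℝ => Complex.log (z + t * η))
      (f' := fun t : ℝ => η / (z + t * η)) ?_ ?_
    · rw [this]; simp
    · intro t ht
      have h0 : HasDerivAt (fun t : ℝ => (t : ℂ)) 1 t := Complex.ofRealCLM.hasDerivAt
      have h1 := ((h0.mul_const η).const_add z).clog_real (hne t ht)
      simpa using h1
    · apply ContinuousOn.intervalIntegrable
      refine ContinuousOn.div (by fun_prop) (by fun_prop) fun t ht => slitPlane_ne_zero (hne t ht)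
  rw [h2, h3, h4] at h1
  rw [h1, neg_neg]

/-- the purely cubic part of the integrand -/
lemma aux_cubic_int (z η : ℂ) (hz : 0 < z.re) (hzη : 0 < (z + η).re) :
    IntegrableOn (fun s : ℝ => (Complex.exp (-(z + η) * s)
      - (1 - η * s + (η * s) ^ 2 / 2) * Complex.exp (-z * s)) / (s:ℂ) ^ 3) (Set.Ioi (0:ℝ)) := by
  have hcont : ContinuousOn (fun s : ℝ => (Complex.exp (-(z + η) * s)
      - (1 - η * s + (η * s) ^ 2 / 2) * Complex.exp (-z * s)) / (s:ℂ) ^ 3) (Set.Ioi (0:ℝ)) := by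
    refine ContinuousOn.div (by fun_prop) (by fun_prop) fun s hs => ?_
    have : (s:ℂ) ≠ 0 := by exact_mod_cast (ne_of_gt hs)
    positivity
  rw [← Set.Ioc_union_Ioi_eq_Ioi (zero_le_one (α := ℝ))]
  refine IntegrableOn.union ?_ ?_
  · have hc : IntegrableOn (fun _ : ℝ => ‖η‖ ^ 3 * Real.exp ‖η‖) (Set.Ioc (0:ℝ) 1) := by
      exact integrableOn_const (by simp)
    refine Integrable.mono' hc ((hcont.mono Set.Ioc_subset_Ioi_self).aestronglyMeasurable
      measurableSet_Ioc) ?_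
    refine (ae_restrict_iff' measurableSet_Ioc).2 (Filter.Eventually.of_forall fun s hs => ?_)
    have hs0 : 0 < s := hs.1
    have h := Complex.norm_exp_sub_sum_le_norm_mul_exp (-η * s) 3
    simp [Finset.sum_range_succ, Nat.factorial] at h
    rw [norm_div, norm_pow, Complex.norm_real, Real.norm_of_nonneg hs0.le,
      div_le_iff₀ (by positivity)]
    rw [abs_of_pos hs0] at h
    have e : Complex.exp (-(z + η) * s) = Complex.exp (-(η * s)) * Complex.exp (-z * s) := by
      rw [← Complex.exp_add]; ring_nf
    have e2 : ‖Complex.exp (-z * s)‖ ≤ 1 := by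
      rw [Complex.norm_exp, Real.exp_le_one_iff]
      simp only [neg_mul, neg_re, re_mul_ofReal]
      nlinarith
    calc _ = ‖cexp (-(η * s)) - (1 + -(η * s) + (η * s) ^ 2 / 2)‖ * ‖Complex.exp (-z * s)‖ := by
          rw [e, ← norm_mul]; congr 1; ring
      _ ≤ ((‖η‖ * s) ^ 3 * Real.exp (‖η‖ * s)) * 1 := by gcongr
      _ ≤ ((‖η‖ * s) ^ 3 * Real.exp (‖η‖ * 1)) * 1 := by gcongr; exact hs.2
      _ = _ := by rw [mul_one]; ring
  · have i1 := (integrableOn_exp_mul_complex_Ioi (a := -(z+η)) (by rw [neg_re]; linarith) 1).norm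
    have i2 := (integrableOn_exp_mul_complex_Ioi (a := -z) (by rw [neg_re]; linarith) 1).norm
    have i3 := i1.add (i2.const_mul (1 + ‖η‖ + ‖η‖ ^ 2 / 2))
    refine Integrable.mono' i3 ((hcont.mono (Set.Ioi_subset_Ioi zero_le_one)).aestronglyMeasurable
      measurableSet_Ioi) ?_
    refine (ae_restrict_iff' measurableSet_Ioi).2 (Filter.Eventually.of_forall fun s hs => ?_)
    have hs1 : 1 < s := hs
    have hs0 : 0 < s := by linarith
    have p : ‖(1 - η * s + (η * s) ^ 2 / 2 : ℂ)‖ ≤ (1 + ‖η‖ + ‖η‖ ^ 2 / 2) * s ^ 3 := by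
      calc _ ≤ ‖(1:ℂ)‖ + ‖η * s‖ + ‖(η * s) ^ 2 / 2‖ :=
            (norm_add_le _ _).trans (by gcongr; exact norm_sub_le _ _)
        _ = 1 + ‖η‖ * s + ‖η‖ ^ 2 / 2 * s ^ 2 := by
            simp [abs_of_pos hs0]; ring
        _ ≤ 1 * s ^ 3 + ‖η‖ * s ^ 3 + ‖η‖ ^ 2 / 2 * s ^ 3 := by
            have a1 : 1 ≤ s ^ 3 := one_le_pow₀ hs1.le
            have a2 : s ≤ s ^ 3 := le_self_pow₀ hs1.le (by norm_num)
            have a3 : s ^ 2 ≤ s ^ 3 := pow_le_pow_right₀ hs1.le (by norm_num)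
            gcongr; linarith
        _ = _ := by ring
    rw [norm_div, norm_pow, Complex.norm_real, Real.norm_of_nonneg hs0.le,
      div_le_iff₀ (by positivity)]
    have a1 : 1 ≤ s ^ 3 := one_le_pow₀ hs1.le
    simp only [Pi.add_apply]
    calc _ ≤ ‖cexp (-(z + η) * s)‖ * 1
          + ‖(1 - η * s + (η * s) ^ 2 / 2 : ℂ)‖ * ‖cexp (-z * s)‖ := by
          rw [mul_one, ← norm_mul]; exact norm_sub_le _ _
      _ ≤ ‖cexp (-(z + η) * s)‖ * s ^ 3
          + ((1 + ‖η‖ + ‖η‖ ^ 2 / 2) * s ^ 3) * ‖cexp (-z * s)‖ := by gcongr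
      _ = _ := by ring

/-- antiderivative -/
noncomputable def auxG (z η : ℂ) (s : ℝ) : ℂ :=
  Complex.exp (-(z + η) * s) * ((z + η) * s - 1) / (2 * (s:ℂ) ^ 2)
    + Complex.exp (-z * s) * (1 - z * s - 2 * η * s) / (2 * (s:ℂ) ^ 2)

lemma auxG_deriv (z η : ℂ) (s : ℝ) (hs : 0 < s) :
    HasDerivAt (auxG z η) ((Complex.exp (-(z + η) * s)
      - (1 - η * s + (η * s) ^ 2 / 2) * Complex.exp (-z * s)) / (s:ℂ) ^ 3
      - (z + η) ^ 2 / 2 * ((Complex.exp (-(z + η) * s) - Complex.exp (-z * s)) / s)) s := by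
  have hs' : (s : ℂ) ≠ 0 := by exact_mod_cast hs.ne'
  have h0 : HasDerivAt (fun t : ℝ => (t : ℂ)) 1 s := Complex.ofRealCLM.hasDerivAt
  have hd : (2 * (s:ℂ) ^ 2) ≠ 0 := mul_ne_zero two_ne_zero (pow_ne_zero 2 hs')
  have hden := (h0.pow 2).const_mul (2:ℂ)
  have hA := (((h0.const_mul (-(z + η))).cexp).mul ((h0.const_mul (z + η)).sub_const 1)).div
    hden hd
  have hB := (((h0.const_mul (-z)).cexp).mul
    (((h0.const_mul z).const_sub 1).sub (h0.const_mul (2 * η)))).div hden hd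
  refine (hA.add hB).congr_deriv ?_
  simp only [Pi.pow_apply, Pi.mul_apply, Pi.sub_apply]
  field_simp
  ring

open Filter Topology in
lemma auxG_zero (z η : ℂ) :
    Tendsto (auxG z η) (𝓝[>] 0) (𝓝 (- (3 * η ^ 2 / 4 + z * η / 2))) := by
  have hA := aux_taylor (z + η)
  have hB := aux_taylor z
  have hs : Tendsto (fun s : ℝ => (s : ℂ)) (𝓝[>] 0) (𝓝 0) :=
    (Complex.continuous_ofReal.tendsto' 0 0 (by simp)).mono_left nhdsWithin_le_nhds
  have hA' := hA.mul (((hs.const_mul (z + η)).sub_const 1).div_const 2)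
  have hB' := hB.mul ((((hs.const_mul z).const_sub 1).sub (hs.const_mul (2 * η))).div_const 2)
  have hp := (hs.mul_const ((z + η) ^ 3 / 4 - z ^ 3 / 4 - η * z ^ 2 / 2)).add_const
    (- (3 * η ^ 2 / 4 + z * η / 2))
  have := (hA'.add hB').add hp
  simp only [zero_mul, zero_add] at this
  refine this.congr' ?_
  filter_upwards [self_mem_nhdsWithin] with s hs
  have hs' : (s : ℂ) ≠ 0 := by exact_mod_cast (ne_of_gt hs)
  unfold auxG
  field_simp
  ring

open Filter Topology in
lemma auxG_top (z η : ℂ) (hz : 0 < z.re) (hzη : 0 < (z + η).re) :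
    Tendsto (auxG z η) atTop (𝓝 0) := by
  have key : ∀ a : ℂ, 0 < a.re → Tendsto (fun s : ℝ => cexp (-a * s)) atTop (𝓝 0) := by
    intro a ha
    have : (-a).re < 0 := by simpa
    simpa [Complex.tendsto_exp_nhds_zero_iff] using tendsto_const_nhds.neg_mul_atTop this tendsto_id
  have hi : Tendsto (fun s : ℝ => ((s : ℂ))⁻¹) atTop (𝓝 0) := by
    have := (Complex.continuous_ofReal.tendsto' 0 0 (by simp)).comp tendsto_inv_atTop_zero
    simpa [Function.comp_def] using this
  have h1 := (key _ hzη).mul (((hi.const_mul (z + η)).sub (hi.pow 2)).div_const 2)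
  have h2 := (key _ hz).mul ((((hi.pow 2).sub (hi.const_mul z)).sub (hi.const_mul (2 * η))).div_const 2)
  have := h1.add h2
  simp only [zero_mul, zero_add] at this
  refine this.congr' ?_
  filter_upwards [eventually_gt_atTop 0] with s hs
  have hs' : (s : ℂ) ≠ 0 := by exact_mod_cast (ne_of_gt hs)
  unfold auxG
  field_simp

lemma aux_cubic (z η : ℂ) (hz : 0 < z.re) (hzη : 0 < (z + η).re) :
    ∫ s in Set.Ioi (0:ℝ), ((Complex.exp (-(z + η) * s)
      - (1 - η * s + (η * s) ^ 2 / 2) * Complex.exp (-z * s)) / (s:ℂ) ^ 3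
      - (z + η) ^ 2 / 2 * ((Complex.exp (-(z + η) * s) - Complex.exp (-z * s)) / s))
      = 3 * η ^ 2 / 4 + z * η / 2 := by
  have := integral_Ioi_of_hasDerivAt_of_tendsto (a := 0) (m := 0)
    (f := Function.update (auxG z η) 0 (- (3 * η ^ 2 / 4 + z * η / 2)))
    (f' := fun s : ℝ => (Complex.exp (-(z + η) * s)
      - (1 - η * s + (η * s) ^ 2 / 2) * Complex.exp (-z * s)) / (s:ℂ) ^ 3
      - (z + η) ^ 2 / 2 * ((Complex.exp (-(z + η) * s) - Complex.exp (-z * s)) / s)) ?_ ?_ ?_ ?_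
  · rw [this]; simp
  · rw [continuousWithinAt_update_same]
    simpa using auxG_zero z η
  · intro s hs
    refine (auxG_deriv z η s hs).congr_of_eventuallyEq ?_
    filter_upwards [Ioi_mem_nhds hs] with t ht
    exact Function.update_of_ne (ne_of_gt ht) _ _
  · exact (aux_cubic_int z η hz hzη).sub ((aux_frullani_int z η hz hzη).const_mul _)
  · refine (auxG_top z η hz hzη).congr' ?_
    filter_upwards [Filter.eventually_gt_atTop 0] with t ht
    exact (Function.update_of_ne (ne_of_gt ht) _ _).symm

theorem integral_exp_shift_identity (z η : ℂ) (hz : 0 < z.re) (hzη : 0 < (z + η).re) :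
    ∫ s in Set.Ioi (0 : ℝ),
        (1 / (s : ℂ)) *
          ((1 / (s : ℂ) ^ 2 - 1 / 12) * Complex.exp (-(z + η) * s)
            - (1 / (s : ℂ) ^ 2 - η / (s : ℂ) + η ^ 2 / 2 - 1 / 12) * Complex.exp (-z * s))
      = 3 * η ^ 2 / 4 + z * η / 2
          - (1 / 2) * ((z + η) ^ 2 - 1 / 6) * (Complex.log (z + η) - Complex.log z) := by
  have hF := aux_frullani_int z η hz hzη
  have h1 := (aux_cubic_int z η hz hzη).sub (hF.const_mul ((z + η) ^ 2 / 2))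
  have h2 := hF.const_mul ((z + η) ^ 2 / 2 - 1 / 12)
  have h3 := integral_add h1 h2
  simp only [Pi.sub_apply] at h3
  rw [aux_cubic z η hz hzη, integral_const_mul, aux_frullani z η hz hzη] at h3
  refine Eq.trans (setIntegral_congr_fun measurableSet_Ioi fun s hs => ?_) (h3.trans ?_)
  · have hs' : (s : ℂ) ≠ 0 := by exact_mod_cast (ne_of_gt hs)
    field_simp
    ring
  · ring
end
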